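/- Let n ≥ 2 be an integer and let p, ρ be real numbers with 1/2 < p < 1, q = 1 − p, 1 − 1/p < ρ < 1, and ρ ≠ 0. Set p_max = max{p + ρq, (1 − ρ)p} and p_min = min{q + ρp, (1 − ρ)q}. Then the function f(m) = (m·p_max + (n − m − 1)·p) / (m·p_min + (n − m − 1)·q) is strictly increasing on the real interval [0, n − 1]. -/

import Mathlib

/-- The privacy bound `f(m) = (m·p_max + (n−m−1)·p) / (m·p_min + (n−m−1)·q)` of JRR
is strictly increasing in the number of colluders `m` on the real interval `[0, n−1]`. -/
theorem jrr_privacy_bound_strictMonoOn (n : ℕ) (hn : 2 ≤ n) (p q ρ : ℝ)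
    (hp : 1 / 2 < p) (hp1 : p < 1) (hq : q = 1 - p)
    (hρl : 1 - 1 / p < ρ) (hρu : ρ < 1) (hρ0 : ρ ≠ 0)
    (pmax pmin : ℝ) (hpmax : pmax = max (p + ρ * q) ((1 - ρ) * p))
    (hpmin : pmin = min (q + ρ * p) ((1 - ρ) * q)) :
    StrictMonoOn
      (fun m : ℝ => (m * pmax + ((n : ℝ) - m - 1) * p) / (m * pmin + ((n : ℝ) - m - 1) * q))
      (Set.Icc (0 : ℝ) ((n : ℝ) - 1)) := by
  have hp0 : 0 < p := by linarith
  have hq0 : 0 < q := by linarith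
  have hn1 : (2 : ℝ) ≤ n := by exact_mod_cast hn
  have hρp : 0 < q + ρ * p := by
    have h := mul_lt_mul_of_pos_right hρl hp0
    rw [sub_mul, div_mul_cancel₀ _ hp0.ne'] at h
    linarith
  have hmin : 0 < pmin := by
    rw [hpmin]
    exact lt_min hρp (mul_pos (by linarith) hq0)
  have hcross : p * pmin < pmax * q := by
    rcases lt_or_gt_of_ne hρ0 with h | h
    · calc p * pmin ≤ p * (q + ρ * p) :=
            mul_le_mul_of_nonneg_left (hpmin ▸ min_le_left _ _) hp0.le
        _ < (1 - ρ) * p * q := by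
            nlinarith [mul_pos (neg_pos.2 h) (mul_pos hp0 hp0),
              mul_pos (neg_pos.2 h) (mul_pos hp0 hq0)]
        _ ≤ pmax * q := mul_le_mul_of_nonneg_right (hpmax ▸ le_max_right _ _) hq0.le
    · calc p * pmin ≤ p * ((1 - ρ) * q) :=
            mul_le_mul_of_nonneg_left (hpmin ▸ min_le_right _ _) hp0.le
        _ < (p + ρ * q) * q := by
            nlinarith [mul_pos h (mul_pos hq0 hq0), mul_pos h (mul_pos hp0 hq0)]
        _ ≤ pmax * q := mul_le_mul_of_nonneg_right (hpmax ▸ le_max_left _ _) hq0.le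
  have hden : ∀ m ∈ Set.Icc (0 : ℝ) ((n : ℝ) - 1), 0 < m * pmin + ((n : ℝ) - m - 1) * q := by
    rintro m ⟨hm0, hm1⟩
    rcases hm0.eq_or_lt with rfl | hm
    · have := mul_pos (show (0 : ℝ) < n - 0 - 1 by linarith) hq0
      linarith
    · have := mul_nonneg (show (0 : ℝ) ≤ n - m - 1 by linarith) hq0.le
      have := mul_pos hm hmin
      linarith
  intro x hx y hy hxy
  refine (div_lt_div_iff₀ (hden x hx) (hden y hy)).2 ?_
  have := mul_pos (mul_pos (show (0 : ℝ) < n - 1 by linarith) (sub_pos.2 hxy)) (sub_pos.2 hcross)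
  linarith
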